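/- Let n be an odd, squarefree, composite integer with n ≥ 4 such that (∏_{p ∣ n} (p − 2)) divides φ(n) − 1, where the product runs over the distinct prime divisors of n and φ is Euler's totient function. Assume moreover that (φ(n) − 1)/∏_{p ∣ n}(p − 2) ≥ 3. Then n > 5.86 · 10^22. -/

import Mathlib

/-- If the members of `s` outside `t` have value at most `c`, those of `t` outside `s` have value
at least `c`, and `t` is at least as large as `s`, then the product over `t` dominates. -/
theorem Finset.prod_le_prod_of_threshold {s t : Finset ℕ} {f : ℕ → ℚ} {c : ℚ} (hc : 1 ≤ c)
    (hf : ∀ i ∈ s, 0 ≤ f i) (hcard : s.card ≤ t.card) (hs : ∀ i ∈ s \ t, f i ≤ c)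
    (ht : ∀ i ∈ t \ s, c ≤ f i) : ∏ i ∈ s, f i ≤ ∏ i ∈ t, f i := by
  have hsdiff : (s \ t).card ≤ (t \ s).card := by
    have h₁ := Finset.card_sdiff_add_card_inter s t
    have h₂ := Finset.card_sdiff_add_card_inter t s
    rw [Finset.inter_comm] at h₂
    omega
  have hle : ∏ i ∈ s \ t, f i ≤ ∏ i ∈ t \ s, f i :=
    calc ∏ i ∈ s \ t, f i ≤ ∏ _i ∈ s \ t, c :=
          Finset.prod_le_prod (fun i hi => hf i (Finset.mem_sdiff.1 hi).1) hs
      _ = c ^ (s \ t).card := by simp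
      _ ≤ c ^ (t \ s).card := pow_le_pow_right₀ hc hsdiff
      _ = ∏ _i ∈ t \ s, c := by simp
      _ ≤ ∏ i ∈ t \ s, f i := Finset.prod_le_prod (fun _ _ => by linarith) ht
  rw [← Finset.prod_inter_mul_prod_sdiff s t, ← Finset.prod_inter_mul_prod_sdiff t s,
    Finset.inter_comm t s]
  exact mul_le_mul_of_nonneg_left hle
    (Finset.prod_nonneg fun i hi => hf i (Finset.mem_inter.1 hi).1)

theorem one_add_inv_sub_two_le {p q : ℕ} (hp : 3 ≤ p) (hpq : p ≤ q) :
    1 + ((q : ℚ) - 2)⁻¹ ≤ 1 + ((p : ℚ) - 2)⁻¹ := by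
  have hp' : (3 : ℚ) ≤ p := by exact_mod_cast hp
  have hpq' : (p : ℚ) ≤ q := by exact_mod_cast hpq
  gcongr
  linarith

/-- A set of primes `≥ a` has product at least that of the primes in `[a, b]`, or its
quotient `∏ (p - 1) / (p - 2)` is at most that of the primes in `[a, b]`. -/
theorem prod_primes_Icc_le_or {s : Finset ℕ} {a b : ℕ} (ha : 3 ≤ a) (hab : a ≤ b)
    (hs : ∀ p ∈ s, p.Prime ∧ a ≤ p) :
    (∏ p ∈ Finset.Icc a b with p.Prime, p ≤ ∏ p ∈ s, p) ∨
      ∏ p ∈ s, (1 + ((p : ℚ) - 2)⁻¹) ≤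
        ∏ p ∈ Finset.Icc a b with p.Prime, (1 + ((p : ℚ) - 2)⁻¹) := by
  set t := {p ∈ Finset.Icc a b | p.Prime}
  have hout : ∀ p ∈ s \ t, b ≤ p := by
    intro p hp
    obtain ⟨hps, hpt⟩ := Finset.mem_sdiff.1 hp
    by_contra! hlt
    exact hpt (Finset.mem_filter.2
      ⟨Finset.mem_Icc.2 ⟨(hs p hps).2, hlt.le⟩, (hs p hps).1⟩)
  have hin : ∀ p ∈ t, a ≤ p ∧ p ≤ b := fun p hp =>
    Finset.mem_Icc.1 (Finset.mem_filter.1 hp).1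
  have hb : (3 : ℚ) ≤ b := by exact_mod_cast ha.trans hab
  rcases le_total t.card s.card with h | h
  · left
    have := Finset.prod_le_prod_of_threshold (f := fun p => (p : ℚ)) (c := b) (by linarith)
      (fun i _ => by positivity) h
      (fun p hp => by exact_mod_cast (hin p (Finset.mem_sdiff.1 hp).1).2)
      (fun p hp => by exact_mod_cast hout p hp)
    rw [← Nat.cast_prod, ← Nat.cast_prod] at this
    exact_mod_cast this
  · right
    refine Finset.prod_le_prod_of_threshold (c := 1 + ((b : ℚ) - 2)⁻¹) ?_ ?_ h ?_ ?_
    · have : 0 ≤ ((b : ℚ) - 2)⁻¹ := inv_nonneg.2 (by linarith)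
      linarith
    · intro p hp
      have hp' : (3 : ℚ) ≤ p := by exact_mod_cast ha.trans (hs p hp).2
      have : 0 ≤ ((p : ℚ) - 2)⁻¹ := inv_nonneg.2 (by linarith)
      linarith
    · exact fun p hp => one_add_inv_sub_two_le (ha.trans hab) (hout p hp)
    · intro p hp
      have hpt := hin p (Finset.mem_sdiff.1 hp).1
      exact one_add_inv_sub_two_le (ha.trans hpt.1) hpt.2

theorem cast_prod_sub_one_eq {s : Finset ℕ} (hs : ∀ p ∈ s, 3 ≤ p) :
    ((∏ p ∈ s, (p - 1) : ℕ) : ℚ) =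
      (∏ p ∈ s, (1 + ((p : ℚ) - 2)⁻¹)) * ((∏ p ∈ s, (p - 2) : ℕ) : ℚ) := by
  push_cast
  rw [← Finset.prod_mul_distrib]
  refine Finset.prod_congr rfl fun p hp => ?_
  have h3 := hs p hp
  have h3' : (3 : ℚ) ≤ p := by exact_mod_cast h3
  rw [Nat.cast_sub (by omega), Nat.cast_sub (by omega)]
  have : (p : ℚ) - 2 ≠ 0 := by linarith
  push_cast
  field_simp
  ring

theorem Nat.totient_eq_prod_of_squarefree {n : ℕ} (hn : Squarefree n) :
    n.totient = ∏ p ∈ n.primeFactors, (p - 1) := by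
  rw [Nat.totient_eq_div_primeFactors_mul, Nat.prod_primeFactors_of_squarefree hn,
    Nat.div_self (Nat.pos_of_ne_zero hn.ne_zero), one_mul]

/-- For primes `p ≥ 5`, the product of the `p - 1` is `0` or `1` modulo `3`, so twice it is never
`1` modulo `3`. -/
theorem not_three_dvd_of_two_mul_prod_sub_one {s : Finset ℕ} {k : ℕ}
    (hs : ∀ p ∈ s, p.Prime ∧ 5 ≤ p) (h : 2 * ∏ p ∈ s, (p - 1) = k + 1) : ¬ 3 ∣ k := by
  intro hk
  have hmod : ∀ p ∈ s, p - 1 ≡ 1 [MOD 3] := by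
    intro p hp
    have h3 : ¬ 3 ∣ p := fun hd => by
      have := (Nat.prime_dvd_prime_iff_eq Nat.prime_three (hs p hp).1).1 hd
      have := (hs p hp).2
      omega
    have h1 : ¬ 3 ∣ p - 1 := fun hd => by
      have := hd.trans (Finset.dvd_prod_of_mem (fun p => p - 1) hp)
      omega
    have := (hs p hp).2
    unfold Nat.ModEq
    omega
  have hprod : ∏ p ∈ s, (p - 1) ≡ 1 [MOD 3] := by
    simpa using Nat.ModEq.prod hmod
  unfold Nat.ModEq at hprod
  omega

theorem stmt_3 (n : ℕ) (hodd : Odd n) (hsqf : Squarefree n) (hcomp : ¬ n.Prime)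
    (hn : 4 ≤ n)
    (hdvd : (∏ p ∈ n.primeFactors, (p - 2)) ∣ Nat.totient n - 1)
    (hM : 3 ≤ (Nat.totient n - 1) / ∏ p ∈ n.primeFactors, (p - 2)) :
    (5.86 * 10 ^ 22 : ℝ) < (n : ℝ) := by
  suffices hbig : 58600000000000000000001 ≤ n by
    have : (58600000000000000000001 : ℝ) ≤ n := by exact_mod_cast hbig
    norm_num
    linarith
  have hprime : ∀ p ∈ n.primeFactors, p.Prime := fun p hp => Nat.prime_of_mem_primeFactors hp
  have hge3 : ∀ p ∈ n.primeFactors, 3 ≤ p := by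
    intro p hp
    have h2 := (hprime p hp).two_le
    have : Odd p := hodd.of_dvd_nat (Nat.dvd_of_mem_primeFactors hp)
    grind
  have hge5 : ∀ p ∈ n.primeFactors, p ≠ 3 → 5 ≤ p := by
    intro p hp hp3
    have h3 := hge3 p hp
    have : Odd p := hodd.of_dvd_nat (Nat.dvd_of_mem_primeFactors hp)
    grind
  have hprod := Nat.prod_primeFactors_of_squarefree hsqf
  have heven : Even n.totient := Nat.totient_even (by omega)
  have hpos : 0 < n.totient := Nat.totient_pos.2 (by omega)
  obtain ⟨M, hMS⟩ := hdvd
  have hS : 0 < ∏ p ∈ n.primeFactors, (p - 2) := Finset.prod_pos fun p hp => by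
    have := hge3 p hp
    omega
  rw [hMS, Nat.mul_div_cancel_left _ hS] at hM
  have htot : n.totient = (∏ p ∈ n.primeFactors, (p - 2)) * M + 1 := by omega
  have hφ := Nat.totient_eq_prod_of_squarefree hsqf
  by_cases h3 : 3 ∈ n.primeFactors
  · rw [← Finset.mul_prod_erase _ _ h3] at hφ htot hprod
    norm_num at hφ htot
    set s := n.primeFactors.erase 3
    have hs5 : ∀ p ∈ s, p.Prime ∧ 5 ≤ p := fun p hp =>
      ⟨hprime p (Finset.mem_of_mem_erase hp),
        hge5 p (Finset.mem_of_mem_erase hp) (Finset.ne_of_mem_erase hp)⟩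
    have hndvd := not_three_dvd_of_two_mul_prod_sub_one hs5 (hφ.symm.trans htot)
    have hM5 : 5 ≤ M := by
      have hM3 : M ≠ 3 := by
        rintro rfl
        exact hndvd (dvd_mul_left 3 _)
      have hM4 : M ≠ 4 := by
        rintro rfl
        obtain ⟨r, hr⟩ := heven
        omega
      omega
    have hs7 : ∀ p ∈ s, p.Prime ∧ 7 ≤ p := by
      intro p hp
      obtain ⟨hpp, hp5⟩ := hs5 p hp
      have hne5 : p ≠ 5 := by
        rintro rfl
        exact hndvd ((Finset.dvd_prod_of_mem (fun p => p - 2) hp).mul_right M)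
      have hne6 : p ≠ 6 := by
        rintro rfl
        norm_num at hpp
      exact ⟨hpp, by omega⟩
    have hT : {p ∈ Finset.Icc 7 71 | p.Prime} =
        {7, 11, 13, 17, 19, 23, 29, 31, 37, 41, 43, 47, 53, 59, 61, 67, 71} := by
      decide +kernel
    rcases prod_primes_Icc_le_or (b := 71) (by norm_num) (by norm_num) hs7 with h | h
    · rw [hT] at h
      norm_num at h
      omega
    · exfalso
      rw [hT] at h
      have hlt := h.trans_lt (c := (5 / 2 : ℚ)) (by norm_num)
      have hcast := cast_prod_sub_one_eq (s := s) fun p hp => by have := (hs5 p hp).2; omega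
      have hle : 5 * ∏ p ∈ s, (p - 2) ≤ 2 * ∏ p ∈ s, (p - 1) := by nlinarith
      have hle' : (5 : ℚ) * (∏ p ∈ s, (p - 2) : ℕ) ≤ 2 * (∏ p ∈ s, (p - 1) : ℕ) := by
        exact_mod_cast hle
      have hSs : 0 < ∏ p ∈ s, (p - 2) := Finset.prod_pos fun p hp => by
        have := (hs5 p hp).2
        omega
      have hSs' : (0 : ℚ) < (∏ p ∈ s, (p - 2) : ℕ) := by exact_mod_cast hSs
      rw [hcast] at hle'
      nlinarith
  · have hs5 : ∀ p ∈ n.primeFactors, p.Prime ∧ 5 ≤ p := fun p hp =>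
      ⟨hprime p hp, hge5 p hp fun h => h3 (h ▸ hp)⟩
    have hT : {p ∈ Finset.Icc 5 67 | p.Prime} =
        {5, 7, 11, 13, 17, 19, 23, 29, 31, 37, 41, 43, 47, 53, 59, 61, 67} := by
      decide +kernel
    rcases prod_primes_Icc_le_or (b := 67) (by norm_num) (by norm_num) hs5 with h | h
    · rw [hT, hprod] at h
      norm_num at h
      omega
    · exfalso
      rw [hT] at h
      have hlt := h.trans_lt (c := (3 : ℚ)) (by norm_num)
      have hcast := cast_prod_sub_one_eq hge3
      have hle : 3 * ∏ p ∈ n.primeFactors, (p - 2) ≤ ∏ p ∈ n.primeFactors, (p - 1) := by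
        nlinarith
      have hle' : (3 : ℚ) * (∏ p ∈ n.primeFactors, (p - 2) : ℕ) ≤
          (∏ p ∈ n.primeFactors, (p - 1) : ℕ) := by exact_mod_cast hle
      have hS' : (0 : ℚ) < (∏ p ∈ n.primeFactors, (p - 2) : ℕ) := by exact_mod_cast hS
      rw [hcast] at hle'
      nlinarith
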